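/- Let μ, ζ be real constants, and let u : ℝ²×[0,∞) → ℝ², ρ, p : ℝ²×[0,∞) → ℝ, F : ℝ²×[0,∞) → ℝ² be smooth, with ρ everywhere positive, satisfying the 2D momentum equation ρ(∂_t u + (u·∇)u) = μΔu − ∇(p − ζφ) + ρF on ℝ²×(0,∞), where φ = ∇·u. Then the scalar vorticity ω = ∂_1 u² − ∂_2 u¹ satisfies on ℝ²×(0,∞): ∂_t ω = Σ_j ∂_j( (μ/ρ) ∂_j ω ) − (u·∇)ω − φ ω + (ζ+μ)( ∇(1/ρ) ∧ ∇φ ) − ( ∇(1/ρ) ∧ ∇p ) + ∇∧F, where for two-dimensional vectors a, b one sets a∧b = a¹b² − a²b¹ and ∇∧F = ∂_1 F² − ∂_2 F¹. -/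

import Mathlib

noncomputable section

/-- Spatial partial derivative in the `j`-th coordinate direction on `ℝ²`. -/
def pd (j : Fin 2) (f : (Fin 2 → ℝ) → ℝ) (x : Fin 2 → ℝ) : ℝ :=
  fderiv ℝ f x (Pi.single j 1)

/-- The scalar vorticity `ω(x,t) = ∂₁u²(x,t) − ∂₂u¹(x,t)`. -/
def vort (u : (Fin 2 → ℝ) → ℝ → Fin 2 → ℝ) (x : Fin 2 → ℝ) (t : ℝ) : ℝ :=
  pd 0 (fun y => u y t 1) x - pd 1 (fun y => u y t 0) x

/-- The expansion rate `φ(x,t) = ∂₁u¹(x,t) + ∂₂u²(x,t)`. -/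
def expR (u : (Fin 2 → ℝ) → ℝ → Fin 2 → ℝ) (x : Fin 2 → ℝ) (t : ℝ) : ℝ :=
  pd 0 (fun y => u y t 0) x + pd 1 (fun y => u y t 1) x


theorem two_le' : (2 : WithTop ℕ∞) ≤ ((⊤ : ℕ∞) : WithTop ℕ∞) := by
  have h : ((2 : ℕ∞) : WithTop ℕ∞) ≤ ((⊤ : ℕ∞) : WithTop ℕ∞) := WithTop.coe_le_coe.2 le_top
  exact h

theorem contDiff_pd (j : Fin 2) {f : (Fin 2 → ℝ) → ℝ} (hf : ContDiff ℝ (⊤ : ℕ∞) f) :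
    ContDiff ℝ (⊤ : ℕ∞) (pd j f) := by
  have h : ContDiff ℝ (⊤ : ℕ∞) (fderiv ℝ f) := hf.fderiv_right (by simp)
  exact h.clm_apply contDiff_const

theorem dAt {f : (Fin 2 → ℝ) → ℝ} (hf : ContDiff ℝ (⊤ : ℕ∞) f) (x) : DifferentiableAt ℝ f x :=
  (hf.differentiable (by simp)) x

theorem pd_add' (j : Fin 2) {f g : (Fin 2 → ℝ) → ℝ} (hf : ContDiff ℝ (⊤ : ℕ∞) f)
    (hg : ContDiff ℝ (⊤ : ℕ∞) g) (x) : pd j (fun y => f y + g y) x = pd j f x + pd j g x := by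
  unfold pd
  rw [fderiv_fun_add (dAt hf x) (dAt hg x)]; rfl

theorem pd_sub' (j : Fin 2) {f g : (Fin 2 → ℝ) → ℝ} (hf : ContDiff ℝ (⊤ : ℕ∞) f)
    (hg : ContDiff ℝ (⊤ : ℕ∞) g) (x) : pd j (fun y => f y - g y) x = pd j f x - pd j g x := by
  unfold pd
  rw [fderiv_fun_sub (dAt hf x) (dAt hg x)]; rfl

theorem pd_mul' (j : Fin 2) {f g : (Fin 2 → ℝ) → ℝ} (hf : ContDiff ℝ (⊤ : ℕ∞) f)
    (hg : ContDiff ℝ (⊤ : ℕ∞) g) (x) :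
    pd j (fun y => f y * g y) x = f x * pd j g x + pd j f x * g x := by
  unfold pd
  rw [fderiv_fun_mul (dAt hf x) (dAt hg x)]
  simp [mul_comm]

theorem pd_const' (j : Fin 2) (c : ℝ) (x) : pd j (fun _ => c) x = 0 := by
  unfold pd
  simp

theorem pd_comm' (f : (Fin 2 → ℝ) → ℝ) (hf : ContDiff ℝ (⊤ : ℕ∞) f) (x) :
    pd 1 (pd 0 f) x = pd 0 (pd 1 f) x := by
  have h : ContDiff ℝ (⊤ : ℕ∞) (fderiv ℝ f) := hf.fderiv_right (by simp)
  have hd : DifferentiableAt ℝ (fderiv ℝ f) x := (h.differentiable (by simp)) x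
  have hs : IsSymmSndFDerivAt ℝ f x := hf.contDiffAt.isSymmSndFDerivAt (by simpa using two_le')
  have key : ∀ j k : Fin 2, pd j (pd k f) x
      = fderiv ℝ (fderiv ℝ f) x (Pi.single j 1) (Pi.single k 1) := by
    intro j k
    have : pd k f = fun y => fderiv ℝ f y (Pi.single k 1) := rfl
    rw [this]
    unfold pd
    rw [fderiv_clm_apply hd (differentiableAt_const _)]
    simp
  rw [key, key]
  exact hs _ _

theorem core (μ ζ : ℝ) (a b r p F0 F1 : (Fin 2 → ℝ) → ℝ)
    (ha : ContDiff ℝ (⊤ : ℕ∞) a) (hb : ContDiff ℝ (⊤ : ℕ∞) b) (hr : ContDiff ℝ (⊤ : ℕ∞) r)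
    (hp : ContDiff ℝ (⊤ : ℕ∞) p) (h0 : ContDiff ℝ (⊤ : ℕ∞) F0) (h1 : ContDiff ℝ (⊤ : ℕ∞) F1)
    (x : Fin 2 → ℝ) :
    pd 0 (fun y => r y * (μ * (pd 0 (pd 0 b) y + pd 1 (pd 1 b) y)
        - pd 1 (fun y => p y - ζ * (pd 0 a y + pd 1 b y)) y) + F1 y
        - (a y * pd 0 b y + b y * pd 1 b y)) x
    - pd 1 (fun y => r y * (μ * (pd 0 (pd 0 a) y + pd 1 (pd 1 a) y)
        - pd 0 (fun y => p y - ζ * (pd 0 a y + pd 1 b y)) y) + F0 y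
        - (a y * pd 0 a y + b y * pd 1 a y)) x
    = (pd 0 (fun y => (μ * r y) * pd 0 (fun z => pd 0 b z - pd 1 a z) y) x
      + pd 1 (fun y => (μ * r y) * pd 1 (fun z => pd 0 b z - pd 1 a z) y) x)
      - (a x * pd 0 (fun z => pd 0 b z - pd 1 a z) x + b x * pd 1 (fun z => pd 0 b z - pd 1 a z) x)
      - (pd 0 a x + pd 1 b x) * (pd 0 b x - pd 1 a x)
      + (ζ + μ) * (pd 0 r x * pd 1 (fun y => pd 0 a y + pd 1 b y) x
          - pd 1 r x * pd 0 (fun y => pd 0 a y + pd 1 b y) x)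
      - (pd 0 r x * pd 1 p x - pd 1 r x * pd 0 p x)
      + (pd 0 F1 x - pd 1 F0 x) := by
  have C : ∀ (j) {f : (Fin 2 → ℝ) → ℝ}, ContDiff ℝ (⊤ : ℕ∞) f →
    ContDiff ℝ (⊤ : ℕ∞) (fun y => pd j f y) := fun j _ h => contDiff_pd j h
  have a0 := C 0 ha
  have a1 := C 1 ha
  have b0 := C 0 hb
  have b1 := C 1 hb
  have p0 := C 0 hp
  have p1 := C 1 hp
  have a00 := C 0 a0
  have a01 := C 0 a1
  have a10 := C 1 a0
  have a11 := C 1 a1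
  have b00 := C 0 b0
  have b01 := C 0 b1
  have b10 := C 1 b0
  have b11 := C 1 b1
  have comm : ∀ f : (Fin 2 → ℝ) → ℝ, ContDiff ℝ (⊤ : ℕ∞) f →
    pd 1 (pd 0 f) = pd 0 (pd 1 f) := fun f hf => funext (pd_comm' f hf)
  simp (disch := fun_prop) only [pd_add', pd_sub', pd_mul', pd_const']
  simp only [comm p hp, comm a ha, comm b hb, comm (pd 0 a) a0, comm (pd 1 a) a1,
    comm (pd 0 b) b0, comm (pd 1 b) b1]
  ring

theorem swap (G : (Fin 2 → ℝ) × ℝ → ℝ) (x : Fin 2 → ℝ) (t : ℝ)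
    (hG : ∀ y s, 0 < s → ContDiffAt ℝ (⊤ : ℕ∞) G (y, s)) (ht : 0 < t) (j : Fin 2) :
    HasDerivAt (fun s => pd j (fun y => G (y, s)) x)
      (pd j (fun y => deriv (fun s => G (y, s)) t) x) t := by
  have hd : ∀ y s, 0 < s → DifferentiableAt ℝ G (y, s) := fun y s hs =>
    (hG y s hs).differentiableAt (by simp)
  have e1 : ∀ y s, 0 < s → ∀ k, pd k (fun y => G (y, s)) y
      = fderiv ℝ G (y, s) ((Pi.single k 1 : Fin 2 → ℝ), (0 : ℝ)) := by
    intro y s hs k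
    have hq : HasFDerivAt (fun y : Fin 2 → ℝ => (y, s))
        ((ContinuousLinearMap.id ℝ (Fin 2 → ℝ)).prod 0) y :=
      (hasFDerivAt_id y).prodMk (hasFDerivAt_const s y)
    have h := HasFDerivAt.comp y (f := fun y : Fin 2 → ℝ => (y, s)) ((hd y s hs).hasFDerivAt) hq
    have h2 : fderiv ℝ (fun y => G (y, s)) y = _ := h.fderiv
    unfold pd
    rw [h2]
    simp
  have e2 : (fun y => deriv (fun s => G (y, s)) t)
      = fun y => fderiv ℝ G (y, t) ((0 : Fin 2 → ℝ), (1 : ℝ)) := by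
    funext y
    have h := (hd y t ht).hasFDerivAt.comp_hasDerivAt t
      (((hasDerivAt_const t y).prodMk (hasDerivAt_id t)) :
        HasDerivAt (fun s : ℝ => (y, s)) _ t)
    exact h.deriv
  have hdd : HasFDerivAt (fderiv ℝ G) (fderiv ℝ (fderiv ℝ G) (x, t)) (x, t) :=
    (((hG x t ht).fderiv_right (m := 1) (by rw [one_add_one_eq_two]; exact two_le')).differentiableAt
      (by simp)).hasFDerivAt
  have hs : IsSymmSndFDerivAt ℝ G (x, t) := (hG x t ht).isSymmSndFDerivAt (by simpa using two_le')
  have e3 : pd j (fun y => deriv (fun s => G (y, s)) t) x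
      = fderiv ℝ (fderiv ℝ G) (x, t) ((Pi.single j 1 : Fin 2 → ℝ), (0 : ℝ)) (0, 1) := by
    rw [e2]
    have hq : HasFDerivAt (fun y : Fin 2 → ℝ => (y, t))
        ((ContinuousLinearMap.id ℝ (Fin 2 → ℝ)).prod 0) x :=
      (hasFDerivAt_id x).prodMk (hasFDerivAt_const t x)
    have h := HasFDerivAt.comp x (f := fun y : Fin 2 → ℝ => (y, t)) hdd hq
    have h2 := (h.clm_apply (hasFDerivAt_const ((0 : Fin 2 → ℝ), (1 : ℝ)) x)).fderiv
    unfold pd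
    refine (congrArg (fun L : (Fin 2 → ℝ) →L[ℝ] ℝ => L (Pi.single j 1)) h2).trans ?_
    simp
  rw [e3, hs]
  have h := hdd.comp_hasDerivAt t
      (((hasDerivAt_const t x).prodMk (hasDerivAt_id t)) :
        HasDerivAt (fun s : ℝ => (x, s)) _ t)
  have h2 := h.clm_apply (hasDerivAt_const t ((Pi.single j 1 : Fin 2 → ℝ), (0 : ℝ)))
  have h3 : HasDerivAt (fun s => fderiv ℝ G (x, s) ((Pi.single j 1 : Fin 2 → ℝ), (0 : ℝ)))
      (fderiv ℝ (fderiv ℝ G) (x, t) (0, 1) ((Pi.single j 1 : Fin 2 → ℝ), (0 : ℝ))) t := by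
    simpa using h2
  refine h3.congr_of_eventuallyEq ?_
  filter_upwards [lt_mem_nhds ht] with s hs
  exact e1 x s hs j

/-- The 2D vorticity equation for a viscous compressible fluid flow:
`∂_t ω = Σ_j ∂_j((μ/ρ)∂_j ω) − (u·∇)ω − φω + (ζ+μ)(∇(1/ρ)∧∇φ) − (∇(1/ρ)∧∇p) + ∇∧F`,
where for 2D vectors `a∧b = a¹b² − a²b¹` and `∇∧F = ∂₁F² − ∂₂F¹`. -/
theorem statement_14 (μ ζ : ℝ) (u : (Fin 2 → ℝ) → ℝ → Fin 2 → ℝ)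
    (ρ pr : (Fin 2 → ℝ) → ℝ → ℝ) (F : (Fin 2 → ℝ) → ℝ → Fin 2 → ℝ)
    (hu : ContDiffOn ℝ (⊤ : ℕ∞) (fun q : (Fin 2 → ℝ) × ℝ => u q.1 q.2) {q | 0 ≤ q.2})
    (hρ : ContDiffOn ℝ (⊤ : ℕ∞) (fun q : (Fin 2 → ℝ) × ℝ => ρ q.1 q.2) {q | 0 ≤ q.2})
    (hpr : ContDiffOn ℝ (⊤ : ℕ∞) (fun q : (Fin 2 → ℝ) × ℝ => pr q.1 q.2) {q | 0 ≤ q.2})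
    (hF : ContDiffOn ℝ (⊤ : ℕ∞) (fun q : (Fin 2 → ℝ) × ℝ => F q.1 q.2) {q | 0 ≤ q.2})
    (hpos : ∀ x t, 0 ≤ t → 0 < ρ x t)
    (hmom : ∀ (x : Fin 2 → ℝ) (t : ℝ), 0 < t → ∀ i,
      ρ x t * (deriv (fun s => u x s i) t + ∑ j, u x t j * pd j (fun y => u y t i) x)
        = μ * (∑ j, pd j (pd j (fun y => u y t i)) x)
          - pd i (fun y => pr y t - ζ * expR u y t) x + ρ x t * F x t i) :
    ∀ (x : Fin 2 → ℝ) (t : ℝ), 0 < t →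
      deriv (fun s => vort u x s) t
        = (∑ j, pd j (fun y => (μ / ρ y t) * pd j (fun z => vort u z t) y) x)
          - (∑ j, u x t j * pd j (fun y => vort u y t) x)
          - expR u x t * vort u x t
          + (ζ + μ) * (pd 0 (fun y => (ρ y t)⁻¹) x * pd 1 (fun y => expR u y t) x
              - pd 1 (fun y => (ρ y t)⁻¹) x * pd 0 (fun y => expR u y t) x)
          - (pd 0 (fun y => (ρ y t)⁻¹) x * pd 1 (fun y => pr y t) x
              - pd 1 (fun y => (ρ y t)⁻¹) x * pd 0 (fun y => pr y t) x)
          + (pd 0 (fun y => F y t 1) x - pd 1 (fun y => F y t 0) x) := by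
  intro x t ht
  have hn : ∀ (y : Fin 2 → ℝ) (s : ℝ), 0 < s → {q : (Fin 2 → ℝ) × ℝ | 0 ≤ q.2} ∈ nhds (y, s) := by
    intro y s hs
    have : ∀ᶠ q : (Fin 2 → ℝ) × ℝ in nhds (y, s), 0 < q.2 :=
      continuousAt_snd.eventually (lt_mem_nhds hs)
    filter_upwards [this] with q hq using le_of_lt hq
  have slice : ∀ G : (Fin 2 → ℝ) × ℝ → ℝ,
      (∀ y s, 0 < s → ContDiffAt ℝ (⊤ : ℕ∞) G (y, s)) →
      ContDiff ℝ (⊤ : ℕ∞) (fun y => G (y, t)) := by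
    intro G hG
    rw [contDiff_iff_contDiffAt]
    intro y
    exact (hG y t ht).comp y (contDiffAt_id.prodMk contDiffAt_const)
  have huA : ∀ i, ∀ y s, 0 < s →
      ContDiffAt ℝ (⊤ : ℕ∞) (fun q : (Fin 2 → ℝ) × ℝ => u q.1 q.2 i) (y, s) := fun i y s hs =>
    contDiffAt_pi.1 (hu.contDiffAt (hn y s hs)) i
  have hFA : ∀ i, ∀ y s, 0 < s →
      ContDiffAt ℝ (⊤ : ℕ∞) (fun q : (Fin 2 → ℝ) × ℝ => F q.1 q.2 i) (y, s) := fun i y s hs =>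
    contDiffAt_pi.1 (hF.contDiffAt (hn y s hs)) i
  have hus : ∀ i, ContDiff ℝ (⊤ : ℕ∞) (fun y => u y t i) := fun i => slice _ (huA i)
  have hFs : ∀ i, ContDiff ℝ (⊤ : ℕ∞) (fun y => F y t i) := fun i => slice _ (hFA i)
  have hps : ContDiff ℝ (⊤ : ℕ∞) (fun y => pr y t) :=
    slice (fun q => pr q.1 q.2) (fun y s hs => hpr.contDiffAt (hn y s hs))
  have hρs : ContDiff ℝ (⊤ : ℕ∞) (fun y => ρ y t) :=
    slice (fun q => ρ q.1 q.2) (fun y s hs => hρ.contDiffAt (hn y s hs))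
  have hρ0 : ∀ y, ρ y t ≠ 0 := fun y => (hpos y t ht.le).ne'
  have hrs : ContDiff ℝ (⊤ : ℕ∞) (fun y => (ρ y t)⁻¹) := hρs.inv hρ0
  have hut : ∀ i, (fun y => deriv (fun s => u y s i) t) = fun y =>
      (ρ y t)⁻¹ * (μ * (pd 0 (pd 0 (fun y => u y t i)) y + pd 1 (pd 1 (fun y => u y t i)) y)
        - pd i (fun y => pr y t - ζ * expR u y t) y) + F y t i
        - (u y t 0 * pd 0 (fun y => u y t i) y + u y t 1 * pd 1 (fun y => u y t i) y) := by
    intro i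
    funext y
    have h := hmom y t ht i
    simp only [Fin.sum_univ_two] at h
    have h0 := hρ0 y
    field_simp
    linarith
  have hL : deriv (fun s => vort u x s) t
      = pd 0 (fun y => deriv (fun s => u y s 1) t) x
        - pd 1 (fun y => deriv (fun s => u y s 0) t) x :=
    ((swap (fun q => u q.1 q.2 1) x t (huA 1) ht 0).sub
      (swap (fun q => u q.1 q.2 0) x t (huA 0) ht 1)).deriv
  rw [hL, hut 0, hut 1]
  simp only [Fin.sum_univ_two, div_eq_mul_inv]
  exact core μ ζ (fun y => u y t 0) (fun y => u y t 1) (fun y => (ρ y t)⁻¹) (fun y => pr y t)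
    (fun y => F y t 0) (fun y => F y t 1) (hus 0) (hus 1) hrs hps (hFs 0) (hFs 1) x
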